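/- There do not exist nowhere-vanishing smooth functions m, n : ℝ³ → ℝ and a nonzero constant vector C ∈ ℝ⁴ such that L₂N(s,t,w) = m(s,t,w)·N(s,t,w) + n(s,t,w)·C for all (s,t,w) ∈ ℝ³. In other words, no tubular hypersurface obtained by pseudo hyperspheres whose centers lie on a timelike curve in E⁴₁ has generalized L₂ 1-type Gauss map. -/

import Mathlib

noncomputable section

open Real

set_option linter.unusedVariables false

/-- Minkowski inner product on `ℝ⁴` with signature `(-,+,+,+)`. -/
def mink (u v : Fin 4 → ℝ) : ℝ :=
  -(u 0 * v 0) + u 1 * v 1 + u 2 * v 2 + u 3 * v 3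

/-- Gauss map of the tubular hypersurface about a timelike curve. -/
def gaussN (F₂ F₃ F₄ : ℝ → Fin 4 → ℝ) (s t w : ℝ) : Fin 4 → ℝ :=
  -((cos t * cos w) • F₂ s + (sin t * cos w) • F₃ s + (sin w) • F₄ s)

/-- The tubular hypersurface about a timelike curve. -/
def tubeT (r : ℝ) (β F₂ F₃ F₄ : ℝ → Fin 4 → ℝ) (s t w : ℝ) : Fin 4 → ℝ :=
  β s + r • ((cos t * cos w) • F₂ s + (sin t * cos w) • F₃ s + (sin w) • F₄ s)

/-- The function `D(s,t,w) = 1 + r k₁(s) cos t cos w`. -/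
def Dfun (r : ℝ) (k₁ : ℝ → ℝ) (s t w : ℝ) : ℝ := 1 + r * k₁ s * cos t * cos w

/-- The Cheng–Yau operator `ℒ₁` applied to the Gauss map of the tubular hypersurface. -/
def L1N (r : ℝ) (k₁ k₂ : ℝ → ℝ) (F₁ F₂ F₃ F₄ : ℝ → Fin 4 → ℝ) (s t w : ℝ) : Fin 4 → ℝ :=
  (-2 * (deriv k₁ s * cos t + k₁ s * k₂ s * sin t) * cos w / (r * (Dfun r k₁ s t w) ^ 3)) • F₁ s
  + (-2 * (r * k₁ s * (3 * r * k₁ s * cos t ^ 3 * cos w ^ 3 + 2 * cos t ^ 2 * cos (2 * w)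
      + cos (2 * t)) + cos t * cos w) / (r ^ 3 * (Dfun r k₁ s t w) ^ 2)) • F₂ s
  + (-2 * (1 + 3 * r * k₁ s * cos t * cos w) * sin t * cos w / (r ^ 3 * Dfun r k₁ s t w)) • F₃ s
  + (-2 * (1 + 3 * r * k₁ s * cos t * cos w) * sin w / (r ^ 3 * Dfun r k₁ s t w)) • F₄ s

/-- The operator `ℒ₂` applied to the Gauss map of the tubular hypersurface. -/
def L2N (r : ℝ) (k₁ k₂ : ℝ → ℝ) (F₁ F₂ F₃ F₄ : ℝ → Fin 4 → ℝ) (s t w : ℝ) : Fin 4 → ℝ :=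
  ((deriv k₁ s * cos t + k₁ s * k₂ s * sin t) * cos w / (r ^ 2 * (Dfun r k₁ s t w) ^ 3)) • F₁ s
  + (k₁ s * ((r * k₁ s / 2) * (24 * r * k₁ s * cos t ^ 4 * cos w ^ 4
      + 12 * cos t ^ 3 * cos (3 * w) + 19 * cos t * cos w + 9 * cos (3 * t) * cos w)
      + 6 * cos t ^ 2 * cos (2 * w) + 3 * cos (2 * t) - 1)
      / (4 * r ^ 3 * (Dfun r k₁ s t w) ^ 3)) • F₂ s
  + (3 * k₁ s * sin t * cos t * cos w ^ 2 / (r ^ 3 * Dfun r k₁ s t w)) • F₃ s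
  + (3 * k₁ s * cos t * sin w * cos w / (r ^ 3 * Dfun r k₁ s t w)) • F₄ s

theorem mink_add_left (u v w : Fin 4 → ℝ) : mink (u + v) w = mink u w + mink v w := by
  simp only [mink, Pi.add_apply]; ring

theorem mink_smul_left (a : ℝ) (u v : Fin 4 → ℝ) : mink (a • u) v = a * mink u v := by
  simp only [mink, Pi.smul_apply, smul_eq_mul]; ring

theorem mink_neg_left (u v : Fin 4 → ℝ) : mink (-u) v = -mink u v := by
  simp only [mink, Pi.neg_apply]; ring

theorem mink_comm (u v : Fin 4 → ℝ) : mink u v = mink v u := by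
  simp only [mink]; ring

theorem no_generalized_L2_one_type_gauss_map_timelike
    (r : ℝ) (hr : 0 < r)
    (β F₁ F₂ F₃ F₄ : ℝ → Fin 4 → ℝ) (k₁ k₂ k₃ : ℝ → ℝ)
    (hβ : ContDiff ℝ (⊤ : ℕ∞) β) (hF₁ : ContDiff ℝ (⊤ : ℕ∞) F₁) (hF₂ : ContDiff ℝ (⊤ : ℕ∞) F₂)
    (hF₃ : ContDiff ℝ (⊤ : ℕ∞) F₃) (hF₄ : ContDiff ℝ (⊤ : ℕ∞) F₄)
    (hk₁ : ContDiff ℝ (⊤ : ℕ∞) k₁) (hk₂ : ContDiff ℝ (⊤ : ℕ∞) k₂) (hk₃ : ContDiff ℝ (⊤ : ℕ∞) k₃)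
    (hβ' : ∀ s, deriv β s = F₁ s)
    (hF₁₁ : ∀ s, mink (F₁ s) (F₁ s) = -1)
    (hF₂₂ : ∀ s, mink (F₂ s) (F₂ s) = 1)
    (hF₃₃ : ∀ s, mink (F₃ s) (F₃ s) = 1)
    (hF₄₄ : ∀ s, mink (F₄ s) (F₄ s) = 1)
    (hF₁₂ : ∀ s, mink (F₁ s) (F₂ s) = 0)
    (hF₁₃ : ∀ s, mink (F₁ s) (F₃ s) = 0)
    (hF₁₄ : ∀ s, mink (F₁ s) (F₄ s) = 0)
    (hF₂₃ : ∀ s, mink (F₂ s) (F₃ s) = 0)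
    (hF₂₄ : ∀ s, mink (F₂ s) (F₄ s) = 0)
    (hF₃₄ : ∀ s, mink (F₃ s) (F₄ s) = 0)
    (hFr₁ : ∀ s, deriv F₁ s = k₁ s • F₂ s)
    (hFr₂ : ∀ s, deriv F₂ s = k₁ s • F₁ s + k₂ s • F₃ s)
    (hFr₃ : ∀ s, deriv F₃ s = (-(k₂ s)) • F₂ s + k₃ s • F₄ s)
    (hFr₄ : ∀ s, deriv F₄ s = (-(k₃ s)) • F₃ s)
    (hD : ∀ s t w : ℝ, Dfun r k₁ s t w ≠ 0)
    :
    ¬ ∃ (m n : ℝ × ℝ × ℝ → ℝ) (C : Fin 4 → ℝ),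
      ContDiff ℝ (⊤ : ℕ∞) m ∧ ContDiff ℝ (⊤ : ℕ∞) n ∧ (∀ p, m p ≠ 0) ∧ (∀ p, n p ≠ 0) ∧ C ≠ 0 ∧
        ∀ s t w : ℝ, L2N r k₁ k₂ F₁ F₂ F₃ F₄ s t w
          = m (s, t, w) • gaussN F₂ F₃ F₄ s t w + n (s, t, w) • C := by
  rintro ⟨m, n, C, -, -, hm, hn, -, h⟩
  have h₄₃ : mink (F₄ 0) (F₃ 0) = 0 := (mink_comm _ _).trans (hF₃₄ 0)
  -- The `F₃`-component of the equation at the Gauss map direction `-F₃` forces `⟨C, F₃⟩ ≠ 0`,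
  -- whereas at the direction `-F₄` it forces `⟨C, F₃⟩ = 0`.
  have e₃ := congrArg (mink · (F₃ 0)) (h 0 (π / 2) 0)
  have e₄ := congrArg (mink · (F₃ 0)) (h 0 0 (π / 2))
  simp [L2N, gaussN, mink_add_left, mink_smul_left, mink_neg_left,
    hF₁₃, hF₂₃, hF₃₃, h₄₃] at e₃ e₄
  have hC : mink C (F₃ 0) = 0 := e₄.resolve_left (hn _)
  rw [hC, mul_zero, add_zero] at e₃
  exact hm (0, π / 2, 0) (by linarith)
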